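/- Let d ≥ 3 and let ξ^(h) ∈ C¹([0,∞); ℝ^d) be the unique global solution of (d/dt) ξ^(h) = 𝓕^(h)(ξ^(h)), ξ^(h)(0) = ξ₀. Then the family of derivatives is uniformly bounded in h: for every h > 0, sup_{t ≥ 0} |(d/dt) ξ^(h)(t)| ≤ 2 C_g^1, where C_g^1 = ‖g‖_{L¹} + (d/2 − 1) π^{d/2} ‖ĝ‖_{L¹}. -/

import Mathlib

open MeasureTheory Filter Set
open scoped RealInnerProductSpace Topology ENNReal

noncomputable section

abbrev E (d : ℕ) := EuclideanSpace ℝ (Fin d)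

/-- `g(η) = η |f(η)|²`. -/
def gfun {d : ℕ} (f : SchwartzMap (E d) ℂ) (η : E d) : E d := ‖f η‖ ^ 2 • η

/-- the average `⨍_a^b u(σ) dσ`. -/
def intAvg {d : ℕ} (u : ℝ → E d) (a b : ℝ) : E d := (b - a)⁻¹ • ∫ σ in a..b, u σ

/-- `𝓕^(h)(u)(t)`; since `g` is real-valued, taking the real part of the complex
integral amounts to replacing `e^{-irθ}` by `cos (rθ)`. -/
def calF {d : ℕ} (f : SchwartzMap (E d) ℂ) (h : ℝ) (u : ℝ → E d) (t : ℝ) : E d :=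
  (-2 : ℝ) • ∫ η, (∫ r in (0:ℝ)..(t / h),
    Real.cos (r * (‖η‖ ^ 2 - 2 * ⟪η, intAvg u (t - h * r) t⟫))) • gfun f η

/-- the `i`-th component of the Fourier transform `ĝ(x) = (2π)^{-d/2} ∫ e^{-ix·η} g(η) dη`. -/
def ftGi {d : ℕ} (f : SchwartzMap (E d) ℂ) (i : Fin d) (x : E d) : ℂ :=
  ((2 * Real.pi) ^ (-(d : ℝ) / 2) : ℝ) *
    ∫ η, Complex.exp (-Complex.I * (⟪x, η⟫ : ℝ)) * ((gfun f η i : ℝ) : ℂ)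

/-- `‖g‖_{L¹}`. -/
def L1g {d : ℕ} (f : SchwartzMap (E d) ℂ) : ℝ := ∫ η, ‖gfun f η‖

/-- `‖ĝ‖_{L¹}` (with the euclidean norm of the complex vector `ĝ(x)`). -/
def L1ftg {d : ℕ} (f : SchwartzMap (E d) ℂ) : ℝ :=
  ∫ x, Real.sqrt (∑ i, ‖ftGi f i x‖ ^ 2)

/-- `C_g^1 = ‖g‖_{L¹} + (d/2 − 1) π^{d/2} ‖ĝ‖_{L¹}`. -/
def Cg1 {d : ℕ} (f : SchwartzMap (E d) ℂ) : ℝ :=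
  L1g f + ((d : ℝ) / 2 - 1) * Real.pi ^ ((d : ℝ) / 2) * L1ftg f

open scoped FourierTransform SchwartzMap

section OscillatoryIntegral

variable {V : Type*} [NormedAddCommGroup V] [InnerProductSpace ℝ V] [FiniteDimensional ℝ V]
  [MeasurableSpace V] [BorelSpace V]

/-- The Fourier transform of a modulated complex Gaussian is bounded by its value at the centre. -/
lemma norm_fourier_gaussian_le {b : ℂ} (hb : 0 < b.re) (x w : V) :
    ‖𝓕 (fun v : V ↦ Complex.exp (-b * ‖v‖ ^ 2 + 2 * Real.pi * Complex.I * ⟪x, v⟫)) w‖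
      ≤ (Real.pi / ‖b‖) ^ ((Module.finrank ℝ V : ℝ) / 2) := by
  rw [fourier_gaussian_innerProductSpace' hb, norm_mul, Complex.norm_exp]
  have h1 : ‖((Real.pi : ℂ) / b) ^ (Module.finrank ℝ V / 2 : ℂ)‖
      = (Real.pi / ‖b‖) ^ ((Module.finrank ℝ V : ℝ) / 2) := by
    have := Complex.norm_cpow_real ((Real.pi : ℂ) / b) ((Module.finrank ℝ V : ℝ) / 2)
    push_cast at this
    rw [this, norm_div, Complex.norm_real, Real.norm_of_nonneg Real.pi_pos.le]
  rw [h1]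
  refine mul_le_of_le_one_right (by positivity) (Real.exp_le_one_iff.2 ?_)
  have h2 : (-(Real.pi : ℂ) ^ 2 * ‖x - w‖ ^ 2 / b)
      = ((-(Real.pi ^ 2 * ‖x - w‖ ^ 2) : ℝ) : ℂ) * b⁻¹ := by
    push_cast; ring
  rw [h2, Complex.re_ofReal_mul, Complex.inv_re]
  have : 0 ≤ b.re / Complex.normSq b := div_nonneg hb.le (Complex.normSq_nonneg b)
  have h3 : 0 ≤ Real.pi ^ 2 * ‖x - w‖ ^ 2 := by positivity
  nlinarith [mul_nonneg h3 this]

/-- Parseval's bound for a damped Gaussian phase tested against a Schwartz function. -/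
lemma norm_integral_gaussian_mul_le {b : ℂ} (hb : 0 < b.re) (x : V) (φ : 𝓢(V, ℂ)) :
    ‖∫ η, Complex.exp (-b * ‖η‖ ^ 2 + 2 * Real.pi * Complex.I * ⟪x, η⟫) * φ η‖
      ≤ (Real.pi / ‖b‖) ^ ((Module.finrank ℝ V : ℝ) / 2) * ∫ ξ, ‖𝓕 φ ξ‖ := by
  set K : V → ℂ := fun η ↦ Complex.exp (-b * ‖η‖ ^ 2 + 2 * Real.pi * Complex.I * ⟪x, η⟫) with hK
  have hKint : Integrable K := by
    have := GaussianFourier.integrable_cexp_neg_mul_sq_norm_add hb (2 * Real.pi * Complex.I) x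
    simpa [hK] using this
  set ψ : 𝓢(V, ℂ) := 𝓕⁻ φ with hψ
  have hφ : 𝓕 ψ = φ := FourierTransform.fourier_fourierInv_eq φ
  have hpars : ∫ ξ, 𝓕 K ξ * ψ ξ = ∫ η, K η * 𝓕 (ψ : V → ℂ) η := by
    simpa using! VectorFourier.integral_bilin_fourierIntegral_eq_flip (.mul ℂ ℂ) (L := innerₗ V)
      Real.continuous_fourierChar continuous_inner hKint ψ.integrable
  have h1 : ∫ η, K η * φ η = ∫ ξ, 𝓕 K ξ * ψ ξ := by
    rw [hpars, ← SchwartzMap.fourier_coe, hφ]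
  have h2 : ∫ ξ, ‖ψ ξ‖ = ∫ ξ, ‖𝓕 φ ξ‖ := by
    rw [← integral_neg_eq_self]
    congr 1 with ξ
    rw [hψ, SchwartzMap.fourierInv_coe, SchwartzMap.fourier_coe, Real.fourierInv_eq_fourier_neg,
      neg_neg]
  rw [h1, ← h2, ← integral_const_mul]
  refine norm_integral_le_of_norm_le (ψ.integrable.norm.const_mul _) (.of_forall fun ξ ↦ ?_)
  rw [norm_mul]
  gcongr
  exact norm_fourier_gaussian_le hb x ξ

/-- The dispersive estimate: `∫ exp(-ir(|η|² - 2η·v)) φ(η) dη` is `O(r^{-n/2})`, uniformly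
in `v`. -/
lemma norm_integral_phase_mul_le {r : ℝ} (hr : 0 < r) (v : V) (φ : 𝓢(V, ℂ)) :
    ‖∫ η, Complex.exp (-((r * (‖η‖ ^ 2 - 2 * ⟪η, v⟫) : ℝ) * Complex.I)) * φ η‖
      ≤ (Real.pi / r) ^ ((Module.finrank ℝ V : ℝ) / 2) * ∫ ξ, ‖𝓕 φ ξ‖ := by
  set x : V := (r / Real.pi) • v with hx
  let b : ℝ → ℂ := fun ε ↦ ε + r * Complex.I
  let J : ℝ → V → ℂ := fun ε η ↦
    Complex.exp (-b ε * ‖η‖ ^ 2 + 2 * Real.pi * Complex.I * ⟪x, η⟫) * φ η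
  have hJ0 : J 0 = fun η ↦
      Complex.exp (-((r * (‖η‖ ^ 2 - 2 * ⟪η, v⟫) : ℝ) * Complex.I)) * φ η := by
    ext η
    have hπ : (Real.pi : ℂ) ≠ 0 := by exact_mod_cast Real.pi_ne_zero
    simp only [J, b, hx, real_inner_smul_left, real_inner_comm η v]
    congr 2
    push_cast
    field_simp
    ring
  have hlim : Tendsto (fun ε ↦ ∫ η, J ε η) (𝓝[>] 0) (𝓝 (∫ η, J 0 η)) := by
    refine tendsto_integral_filter_of_dominated_convergence (fun η ↦ ‖φ η‖) ?_ ?_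
      φ.integrable.norm ?_
    · refine .of_forall fun ε ↦ Continuous.aestronglyMeasurable ?_
      have := φ.continuous
      fun_prop
    · filter_upwards [self_mem_nhdsWithin] with ε hε
      refine .of_forall fun η ↦ ?_
      simp only [J, norm_mul, Complex.norm_exp]
      refine mul_le_of_le_one_left (norm_nonneg _) (Real.exp_le_one_iff.2 ?_)
      have hε' : 0 < ε := hε
      have : (-b ε * ‖η‖ ^ 2 + 2 * Real.pi * Complex.I * ⟪x, η⟫).re = -(ε * ‖η‖ ^ 2) := by
        have e1 : (-b ε * ‖η‖ ^ 2 + 2 * Real.pi * Complex.I * ⟪x, η⟫)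
          = ((-(ε * ‖η‖ ^ 2) : ℝ) : ℂ)
            + ((-(r * ‖η‖ ^ 2) + 2 * Real.pi * ⟪x, η⟫ : ℝ) : ℂ) * Complex.I := by
          simp only [b]; push_cast; ring
        rw [e1, Complex.add_re, Complex.re_ofReal_mul, Complex.ofReal_re, Complex.I_re]
        ring
      rw [this]
      have : 0 ≤ ε * ‖η‖ ^ 2 := by positivity
      linarith
    · refine .of_forall fun η ↦ ?_
      have : Continuous fun ε ↦ J ε η := by simp only [J, b]; fun_prop
      exact (this.tendsto 0).mono_left nhdsWithin_le_nhds
  rw [← hJ0]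
  refine le_of_tendsto hlim.norm ?_
  filter_upwards [self_mem_nhdsWithin] with ε hε
  have hε' : 0 < ε := hε
  have hb : 0 < (b ε).re := by simpa [b] using hε'
  refine (norm_integral_gaussian_mul_le hb x φ).trans ?_
  have hrb : r ≤ ‖b ε‖ := by
    have := Complex.abs_im_le_norm (b ε)
    simp only [b, Complex.add_im, Complex.ofReal_im, Complex.im_ofReal_mul, Complex.I_im] at this
    exact (le_abs_self r).trans (by simpa using this)
  have : 0 ≤ ∫ ξ, ‖𝓕 φ ξ‖ := by positivity
  gcongr

end OscillatoryIntegral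

section FourierOfG

variable {d : ℕ}

/-- The Schwartz function `η ↦ ⟪e, g(η)⟫`. -/
def gDir (f : 𝓢(E d, ℂ)) (e : E d) : 𝓢(E d, ℂ) :=
  SchwartzMap.smulLeftCLM ℂ (fun η : E d ↦ ((innerSL ℝ e η : ℝ) : ℂ))
    (SchwartzMap.pairing (.mul ℂ ℂ) (SchwartzMap.postcompCLM (Complex.conjCLE : ℂ →L[ℝ] ℂ) f) f)

lemma gDir_apply (f : 𝓢(E d, ℂ)) (e η : E d) : gDir f e η = ((⟪e, gfun f η⟫ : ℝ) : ℂ) := by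
  have hg : Function.HasTemperateGrowth (fun η : E d ↦ ((innerSL ℝ e η : ℝ) : ℂ)) :=
    (Complex.ofRealCLM.comp (innerSL ℝ e)).hasTemperateGrowth
  rw [gDir, SchwartzMap.smulLeftCLM_apply_apply hg]
  simp only [SchwartzMap.pairing_apply_apply, SchwartzMap.postcompCLM_apply, gfun,
    real_inner_smul_right, innerSL_apply_apply, smul_eq_mul, ContinuousLinearMap.mul_apply']
  have : (Complex.conjCLE : ℂ →L[ℝ] ℂ) (f η) * f η = ((‖f η‖ ^ 2 : ℝ) : ℂ) := by
    simpa using Complex.conj_mul' (f η)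
  rw [this]; push_cast; ring

lemma gDir_single_apply (f : 𝓢(E d, ℂ)) (i : Fin d) (η : E d) :
    gDir f (EuclideanSpace.single i 1) η = ((gfun f η i : ℝ) : ℂ) := by
  rw [gDir_apply]; simp [EuclideanSpace.inner_single_left]

lemma ftGi_eq (f : 𝓢(E d, ℂ)) (i : Fin d) (x : E d) :
    ftGi f i x = ((2 * Real.pi) ^ (-(d : ℝ) / 2) : ℝ) *
      𝓕 (gDir f (EuclideanSpace.single i 1)) ((2 * Real.pi)⁻¹ • x) := by
  rw [ftGi, SchwartzMap.fourier_coe, Real.fourier_eq']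
  congr 2 with η
  rw [gDir_single_apply, smul_eq_mul, real_inner_smul_right, real_inner_comm η x]
  congr 2
  have hπ : (Real.pi : ℂ) ≠ 0 := by exact_mod_cast Real.pi_ne_zero
  push_cast
  field_simp

lemma gDir_eq_sum (f : 𝓢(E d, ℂ)) (e : E d) :
    gDir f e = ∑ i, (e i : ℂ) • gDir f (EuclideanSpace.single i 1) := by
  ext η
  rw [sum_apply]
  simp only [smul_apply, gDir_apply, smul_eq_mul]
  simp [PiLp.inner_apply, mul_comm]

lemma integrable_norm_ftG (f : 𝓢(E d, ℂ)) :
    Integrable fun x : E d ↦ Real.sqrt (∑ i, ‖ftGi f i x‖ ^ 2) := by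
  have h2π : (2 * Real.pi)⁻¹ ≠ 0 := by positivity
  have hint (i : Fin d) : Integrable fun x : E d ↦ ftGi f i x := by
    simp only [ftGi_eq]
    exact ((𝓕 (gDir f (EuclideanSpace.single i 1))).integrable.comp_smul h2π).const_mul _
  have hcont (i : Fin d) : Continuous fun x : E d ↦ ftGi f i x := by
    simp only [ftGi_eq]
    have := (𝓕 (gDir f (EuclideanSpace.single i 1))).continuous
    fun_prop
  refine Integrable.mono' (integrable_finsetSum Finset.univ fun i _ ↦ (hint i).norm)
    (by fun_prop) (.of_forall fun x ↦ ?_)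
  rw [Real.norm_of_nonneg (Real.sqrt_nonneg _)]
  refine Real.sqrt_le_iff.2 ⟨by positivity, ?_⟩
  exact Finset.sum_sq_le_sq_sum_of_nonneg fun i _ ↦ norm_nonneg _

lemma L1ftg_nonneg (f : 𝓢(E d, ℂ)) : 0 ≤ L1ftg f := integral_nonneg fun _ ↦ Real.sqrt_nonneg _

lemma norm_fourier_gDir_le (f : 𝓢(E d, ℂ)) (e x : E d) :
    ‖𝓕 (gDir f e) x‖ ≤ (2 * Real.pi) ^ ((d : ℝ) / 2) * ‖e‖ *
      Real.sqrt (∑ i, ‖ftGi f i ((2 * Real.pi) • x)‖ ^ 2) := by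
  have h2π : (0 : ℝ) < 2 * Real.pi := by positivity
  have hft (i : Fin d) : 𝓕 (gDir f (EuclideanSpace.single i 1)) x
      = ((2 * Real.pi) ^ ((d : ℝ) / 2) : ℝ) * ftGi f i ((2 * Real.pi) • x) := by
    rw [ftGi_eq, inv_smul_smul₀ h2π.ne', ← mul_assoc, ← Complex.ofReal_mul,
      ← Real.rpow_add h2π]
    simp [neg_div]
  have hsum : 𝓕 (gDir f e) = ∑ i, (e i : ℂ) • 𝓕 (gDir f (EuclideanSpace.single i 1)) := by
    rw [gDir_eq_sum]
    simp only [← FourierTransform.fourierCLM_apply (R := ℂ), map_sum, map_smul]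
  rw [hsum, sum_apply]
  simp only [smul_apply, hft, smul_eq_mul]
  calc ‖∑ i, (e i : ℂ) * (((2 * Real.pi) ^ ((d : ℝ) / 2) : ℝ) * ftGi f i ((2 * Real.pi) • x))‖
      ≤ ∑ i, ‖(e i : ℂ) * (((2 * Real.pi) ^ ((d : ℝ) / 2) : ℝ) *
          ftGi f i ((2 * Real.pi) • x))‖ := norm_sum_le _ _
    _ = (2 * Real.pi) ^ ((d : ℝ) / 2) * ∑ i, ‖e i‖ * ‖ftGi f i ((2 * Real.pi) • x)‖ := by
        rw [Finset.mul_sum]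
        refine Finset.sum_congr rfl fun i _ ↦ ?_
        rw [norm_mul, norm_mul, Complex.norm_real, Complex.norm_real,
          Real.norm_of_nonneg (Real.rpow_nonneg h2π.le _)]
        ring
    _ ≤ _ := by
        rw [mul_assoc, EuclideanSpace.norm_eq]
        gcongr
        exact Real.sum_mul_le_sqrt_mul_sqrt _ _ _

lemma integral_norm_fourier_gDir_le (f : 𝓢(E d, ℂ)) (e : E d) :
    ∫ x, ‖𝓕 (gDir f e) x‖ ≤ (2 * Real.pi) ^ (-((d : ℝ) / 2)) * ‖e‖ * L1ftg f := by
  have h2π : (0 : ℝ) < 2 * Real.pi := by positivity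
  calc ∫ x, ‖𝓕 (gDir f e) x‖
      ≤ ∫ x, (2 * Real.pi) ^ ((d : ℝ) / 2) * ‖e‖ *
        Real.sqrt (∑ i, ‖ftGi f i ((2 * Real.pi) • x)‖ ^ 2) :=
        integral_mono (𝓕 (gDir f e)).integrable.norm
          (((integrable_norm_ftG f).comp_smul h2π.ne').const_mul _)
          (norm_fourier_gDir_le f e)
    _ = (2 * Real.pi) ^ ((d : ℝ) / 2) * ‖e‖ * (((2 * Real.pi) ^ d)⁻¹ * L1ftg f) := by
        rw [integral_const_mul, L1ftg, Measure.integral_comp_smul_of_nonneg (hR := h2π.le) volume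
          (fun x : E d ↦ Real.sqrt (∑ i, ‖ftGi f i x‖ ^ 2))]
        simp
    _ = _ := by
        have : (2 * Real.pi) ^ (-((d : ℝ) / 2))
            = (2 * Real.pi) ^ ((d : ℝ) / 2) * ((2 * Real.pi) ^ d)⁻¹ := by
          rw [← Real.rpow_natCast, ← Real.rpow_neg h2π.le, ← Real.rpow_add h2π]
          congr 1; ring
        rw [this]; ring

end FourierOfG

section Dispersion

variable {d : ℕ}

lemma continuous_gfun (f : 𝓢(E d, ℂ)) : Continuous (gfun f) := by
  have := f.continuous
  unfold gfun
  fun_prop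

lemma integrable_gfun (f : 𝓢(E d, ℂ)) : Integrable (gfun f) := by
  refine Integrable.mono' (integrable_finsetSum Finset.univ fun i _ ↦
    (gDir f (EuclideanSpace.single i 1)).integrable.norm)
    (continuous_gfun f).aestronglyMeasurable (.of_forall fun η ↦ ?_)
  simp only [gDir_single_apply, Complex.norm_real]
  rw [EuclideanSpace.norm_eq]
  refine Real.sqrt_le_iff.2 ⟨by positivity, ?_⟩
  exact Finset.sum_sq_le_sq_sum_of_nonneg fun i _ ↦ norm_nonneg _

lemma norm_cos_smul_gfun_le (f : 𝓢(E d, ℂ)) (a : ℝ) (η : E d) :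
    ‖Real.cos a • gfun f η‖ ≤ ‖gfun f η‖ := by
  rw [norm_smul]
  exact mul_le_of_le_one_left (norm_nonneg _) (Real.abs_cos_le_one a)

/-- The oscillatory integral is bounded by the `L¹` norm of `g`. -/
lemma norm_integral_cos_smul_le_L1g (f : 𝓢(E d, ℂ)) (r : ℝ) (v : E d) :
    ‖∫ η, Real.cos (r * (‖η‖ ^ 2 - 2 * ⟪η, v⟫)) • gfun f η‖ ≤ L1g f :=
  norm_integral_le_of_norm_le (integrable_gfun f).norm
    (.of_forall fun η ↦ norm_cos_smul_gfun_le f _ η)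

/-- The oscillatory integral decays like `(2r)^{-d/2}`, uniformly in the velocity `v`. -/
lemma norm_integral_cos_smul_le_rpow (f : 𝓢(E d, ℂ)) {r : ℝ} (hr : 0 < r) (v : E d) :
    ‖∫ η, Real.cos (r * (‖η‖ ^ 2 - 2 * ⟪η, v⟫)) • gfun f η‖
      ≤ (2 * r) ^ (-((d : ℝ) / 2)) * L1ftg f := by
  set X := ∫ η, Real.cos (r * (‖η‖ ^ 2 - 2 * ⟪η, v⟫)) • gfun f η with hX
  have hint : Integrable fun η ↦ Real.cos (r * (‖η‖ ^ 2 - 2 * ⟪η, v⟫)) • gfun f η := by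
    refine (integrable_gfun f).mono (Continuous.aestronglyMeasurable ?_)
      (.of_forall fun η ↦ norm_cos_smul_gfun_le f _ η)
    have := continuous_gfun f
    fun_prop
  let P : E d → ℂ := fun η ↦
    Complex.exp (-((r * (‖η‖ ^ 2 - 2 * ⟪η, v⟫) : ℝ) * Complex.I)) * gDir f X η
  have hP : Integrable P := by
    refine (gDir f X).integrable.mono (Continuous.aestronglyMeasurable ?_)
      (.of_forall fun η ↦ ?_)
    · have := (gDir f X).continuous
      fun_prop
    · simp only [P]
      rw [norm_mul, ← neg_mul, ← Complex.ofReal_neg, Complex.norm_exp_ofReal_mul_I, one_mul]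
  have hre (η : E d) : ⟪X, Real.cos (r * (‖η‖ ^ 2 - 2 * ⟪η, v⟫)) • gfun f η⟫ = (P η).re := by
    simp only [P]
    rw [real_inner_smul_right, gDir_apply, ← neg_mul, ← Complex.ofReal_neg, mul_comm (Complex.exp _),
      Complex.re_ofReal_mul, Complex.exp_ofReal_mul_I_re, Real.cos_neg, mul_comm]
  have hsq : ‖X‖ * ‖X‖ ≤ ‖X‖ * ((2 * r) ^ (-((d : ℝ) / 2)) * L1ftg f) := by
    calc ‖X‖ * ‖X‖ = ⟪X, X⟫ := (real_inner_self_eq_norm_mul_norm X).symm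
      _ = ∫ η, ⟪X, Real.cos (r * (‖η‖ ^ 2 - 2 * ⟪η, v⟫)) • gfun f η⟫ :=
          (integral_inner hint X).symm
      _ = (∫ η, P η).re := by
          simp only [hre]
          exact integral_re hP
      _ ≤ ‖∫ η, P η‖ := Complex.re_le_norm _
      _ ≤ (Real.pi / r) ^ ((d : ℝ) / 2) * ∫ ξ, ‖𝓕 (gDir f X) ξ‖ := by
          simpa [P] using norm_integral_phase_mul_le hr v (gDir f X)
      _ ≤ (Real.pi / r) ^ ((d : ℝ) / 2) *
            ((2 * Real.pi) ^ (-((d : ℝ) / 2)) * ‖X‖ * L1ftg f) := by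
          gcongr
          exact integral_norm_fourier_gDir_le f X
      _ = _ := by
          have h2π : (0 : ℝ) ≤ 2 * Real.pi := by positivity
          have : (2 * r) ^ (-((d : ℝ) / 2))
              = (Real.pi / r) ^ ((d : ℝ) / 2) * (2 * Real.pi) ^ (-((d : ℝ) / 2)) := by
            rw [Real.rpow_neg (by positivity), Real.rpow_neg h2π, ← div_eq_mul_inv,
              ← Real.div_rpow (by positivity) h2π, ← Real.inv_rpow (by positivity)]
            congr 1
            field_simp
          rw [this]; ring
  rcases (norm_nonneg X).eq_or_lt' with h0 | h0
  · rw [h0]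
    exact mul_nonneg (by positivity) (L1ftg_nonneg f)
  · exact le_of_mul_le_mul_left hsq h0

lemma integral_two_mul_rpow_le (hd : 3 ≤ d) {T : ℝ} (hT : 1 ≤ T) :
    ∫ r in (1 : ℝ)..T, (2 * r) ^ (-((d : ℝ) / 2))
      ≤ ((d : ℝ) / 2 - 1) * Real.pi ^ ((d : ℝ) / 2) := by
  have hd' : (3 : ℝ) ≤ d := by exact_mod_cast hd
  set s : ℝ := (d : ℝ) / 2 with hs
  have hs' : 3 / 2 ≤ s := by linarith
  have h1 : ∫ r in (1 : ℝ)..T, (2 * r) ^ (-s) = 2 ^ (-s) * ((1 - T ^ (1 - s)) / (s - 1)) := by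
    have : ∀ r ∈ Set.uIcc 1 T, (2 * r) ^ (-s) = (2 : ℝ) ^ (-s) * r ^ (-s) := by
      intro r hr
      rw [Set.uIcc_of_le hT] at hr
      exact Real.mul_rpow (by norm_num) (by linarith [hr.1])
    rw [intervalIntegral.integral_congr this, intervalIntegral.integral_const_mul, integral_rpow]
    · rw [Real.one_rpow, show -s + 1 = 1 - s by ring, ← neg_div_neg_eq, neg_sub, neg_sub]
    · right
      refine ⟨by linarith, ?_⟩
      rw [Set.uIcc_of_le hT]
      exact fun h ↦ by linarith [h.1]
  rw [h1]
  have h2 : (1 - T ^ (1 - s)) / (s - 1) ≤ 2 := by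
    have : 0 ≤ T ^ (1 - s) := by positivity
    rw [div_le_iff₀ (by linarith)]; linarith
  have h3 : (2 : ℝ) ^ (-s) ≤ 1 / 2 := by
    calc (2 : ℝ) ^ (-s) ≤ 2 ^ (-1 : ℝ) :=
          Real.rpow_le_rpow_of_exponent_le (by norm_num) (by linarith)
      _ = 1 / 2 := by rw [Real.rpow_neg_one]; norm_num
  have h4 : (3 : ℝ) ≤ Real.pi ^ s := by
    calc (3 : ℝ) ≤ Real.pi ^ (1 : ℝ) := by rw [Real.rpow_one]; exact Real.pi_gt_three.le
      _ ≤ Real.pi ^ s :=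
        Real.rpow_le_rpow_of_exponent_le (by linarith [Real.pi_gt_three]) (by linarith)
  have h5 : (0 : ℝ) < 2 ^ (-s) := by positivity
  calc (2 : ℝ) ^ (-s) * ((1 - T ^ (1 - s)) / (s - 1)) ≤ (2 : ℝ) ^ (-s) * 2 := by gcongr
    _ ≤ 1 / 2 * 3 := by linarith
    _ ≤ (s - 1) * Real.pi ^ s := mul_le_mul (by linarith) h4 (by norm_num) (by linarith)

/-- The time integral of the oscillatory integrals along any measurable path of velocities is
bounded by `C_g^1`. -/
lemma norm_integral_integral_cos_smul_le (hd : 3 ≤ d) (f : 𝓢(E d, ℂ)) {A : ℝ → E d}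
    (hA : Measurable A) {T : ℝ} (hT : 0 ≤ T) :
    ‖∫ η, (∫ r in (0 : ℝ)..T, Real.cos (r * (‖η‖ ^ 2 - 2 * ⟪η, A r⟫))) • gfun f η‖
      ≤ Cg1 f := by
  let F : E d → ℝ → E d := fun η r ↦ Real.cos (r * (‖η‖ ^ 2 - 2 * ⟪η, A r⟫)) • gfun f η
  let W : ℝ → E d := fun r ↦ ∫ η, F η r
  have hF : Integrable (Function.uncurry F) (volume.prod (volume.restrict (Set.Ioc 0 T))) := by
    refine ((integrable_gfun f).comp_fst (volume.restrict (Set.Ioc 0 T))).mono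
      (Measurable.aestronglyMeasurable ?_)
      (.of_forall fun p ↦ norm_cos_smul_gfun_le f _ p.1)
    have := (continuous_gfun f).measurable
    simp only [F, Function.uncurry_def]
    fun_prop
  have hswap : ∫ η, (∫ r in (0 : ℝ)..T, Real.cos (r * (‖η‖ ^ 2 - 2 * ⟪η, A r⟫))) • gfun f η
      = ∫ r in (0 : ℝ)..T, W r := by
    simp_rw [← intervalIntegral.integral_smul_const, intervalIntegral.integral_of_le hT]
    exact integral_integral_swap hF
  have hW : IntervalIntegrable W volume 0 T :=
    (intervalIntegrable_iff_integrableOn_Ioc_of_le hT).2 hF.integral_prod_right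
  have hL : 0 ≤ L1g f := integral_nonneg fun _ ↦ norm_nonneg _
  have hd' : (3 : ℝ) ≤ d := by exact_mod_cast hd
  have hshort {S : ℝ} (hS : 0 ≤ S) (hS1 : S ≤ 1) : ‖∫ r in (0 : ℝ)..S, W r‖ ≤ L1g f := by
    refine (intervalIntegral.norm_integral_le_of_norm_le_const
      fun r _ ↦ norm_integral_cos_smul_le_L1g f r (A r)).trans ?_
    rw [sub_zero, abs_of_nonneg hS]
    exact mul_le_of_le_one_right hL hS1
  rw [hswap, Cg1]
  rcases le_total T 1 with h1 | h1
  · refine (hshort hT h1).trans (le_add_of_nonneg_right ?_)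
    have := L1ftg_nonneg f
    have : 0 ≤ (d : ℝ) / 2 - 1 := by linarith
    positivity
  · have h01 : (1 : ℝ) ∈ Set.uIcc 0 T := by rw [Set.uIcc_of_le hT]; exact ⟨zero_le_one, h1⟩
    rw [← intervalIntegral.integral_add_adjacent_intervals
      (hW.mono_set (Set.uIcc_subset_uIcc_left h01)) (hW.mono_set (Set.uIcc_subset_uIcc_right h01))]
    refine (norm_add_le _ _).trans (add_le_add (hshort zero_le_one le_rfl) ?_)
    have hcont : ContinuousOn (fun r : ℝ ↦ (2 * r) ^ (-((d : ℝ) / 2)) * L1ftg f)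
        (Set.uIcc 1 T) := by
      rw [Set.uIcc_of_le h1]
      refine ContinuousOn.mul (ContinuousOn.rpow_const (by fun_prop) fun r hr ↦ Or.inl ?_)
        continuousOn_const
      linarith [hr.1]
    calc ‖∫ r in (1 : ℝ)..T, W r‖
        ≤ ∫ r in (1 : ℝ)..T, (2 * r) ^ (-((d : ℝ) / 2)) * L1ftg f :=
          intervalIntegral.norm_integral_le_of_norm_le h1
            (.of_forall fun r hr ↦
              norm_integral_cos_smul_le_rpow f (zero_lt_one.trans hr.1) (A r))
            hcont.intervalIntegrable
      _ = (∫ r in (1 : ℝ)..T, (2 * r) ^ (-((d : ℝ) / 2))) * L1ftg f :=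
          intervalIntegral.integral_mul_const _ _
      _ ≤ _ := mul_le_mul_of_nonneg_right (integral_two_mul_rpow_le hd h1) (L1ftg_nonneg f)

lemma measurable_intAvg {u : ℝ → E d} (hu : Continuous u) (t h : ℝ) :
    Measurable fun r : ℝ ↦ intAvg u (t - h * r) t := by
  have h1 : Continuous fun r : ℝ ↦ ∫ σ in (t - h * r)..t, u σ := by
    have h2 : Continuous fun b : ℝ ↦ ∫ σ in t..b, u σ :=
      intervalIntegral.continuous_primitive (fun a b ↦ hu.intervalIntegrable a b) t
    have h3 : (fun r : ℝ ↦ ∫ σ in (t - h * r)..t, u σ)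
        = fun r ↦ -∫ σ in t..(t - h * r), u σ := by
      ext1 r; exact intervalIntegral.integral_symm _ _
    rw [h3]
    exact (h2.comp (by fun_prop : Continuous fun r : ℝ ↦ t - h * r)).neg
  have := h1.measurable
  unfold intAvg
  fun_prop

/-- For a path continuous on `[0, ∞)`, the force `𝓕^(h)` is bounded by `2 C_g^1`. -/
lemma norm_calF_le (hd : 3 ≤ d) (f : 𝓢(E d, ℂ)) {h : ℝ} (hh : 0 < h) {u : ℝ → E d}
    (hu : ContinuousOn u (Set.Ici 0)) {t : ℝ} (ht : 0 ≤ t) : ‖calF f h u t‖ ≤ 2 * Cg1 f := by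
  let u' : ℝ → E d := fun s ↦ u (max 0 s)
  have hu' : Continuous u' :=
    hu.comp_continuous (by fun_prop) fun s ↦ le_max_left 0 s
  have hT : 0 ≤ t / h := by positivity
  have havg : ∀ r ∈ Set.uIcc 0 (t / h), intAvg u (t - h * r) t = intAvg u' (t - h * r) t := by
    intro r hr
    rw [Set.uIcc_of_le hT] at hr
    have h1 : 0 ≤ t - h * r := by
      have := (le_div_iff₀ hh).1 hr.2
      linarith
    unfold intAvg
    congr 1
    refine intervalIntegral.integral_congr fun σ hσ ↦ ?_
    have : 0 ≤ σ := (le_inf h1 ht).trans hσ.1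
    simp only [u', max_eq_right this]
  have hcalF : calF f h u t = (-2 : ℝ) • ∫ η, (∫ r in (0 : ℝ)..(t / h),
      Real.cos (r * (‖η‖ ^ 2 - 2 * ⟪η, intAvg u' (t - h * r) t⟫))) • gfun f η := by
    unfold calF
    congr 2 with η : 1
    congr 1
    refine intervalIntegral.integral_congr fun r hr ↦ ?_
    simp only [havg r hr]
  rw [hcalF, norm_smul, norm_neg, Real.norm_ofNat]
  gcongr
  exact norm_integral_integral_cos_smul_le hd f (measurable_intAvg hu' t h) hT

end Dispersion

/-- in dimension `d ≥ 3`, for any `h > 0`, if `ξ^(h)` is the global solution of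
`(d/dt) ξ^(h) = 𝓕^(h)(ξ^(h))`, `ξ^(h)(0) = ξ₀`, then `sup_{t ≥ 0} |(d/dt) ξ^(h)(t)| ≤ 2 C_g^1`
(the derivative being `𝓕^(h)(ξ^(h))(t)` itself). -/
theorem statement3 (d : ℕ) (hd : 3 ≤ d) (f : SchwartzMap (E d) ℂ) (ξ₀ : E d) (hξ₀ : ξ₀ ≠ 0)
    (h : ℝ) (hh : 0 < h) (ξ : ℝ → E d) (hinit : ξ 0 = ξ₀)
    (hsol : ∀ t ∈ Set.Ici (0 : ℝ), HasDerivWithinAt ξ (calF f h ξ t) (Set.Ici (0 : ℝ)) t) :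
    ∀ t ∈ Set.Ici (0 : ℝ), ‖calF f h ξ t‖ ≤ 2 * Cg1 f := by
  exact fun t ht ↦ norm_calF_le hd f hh (fun s hs ↦ (hsol s hs).continuousWithinAt) ht
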